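/- Let a₁,…,a₇ be positive integers such that no positive definite integral ternary quadratic form represents all seven of them. Then: (i) for all i ≠ j, the product a_i·a_j is not a square in ℚ₂, and 6·a_i is not a square in ℚ₂ for any i; (ii) there exist indices i and j such that 3·a_i is a square in ℚ₃ and 6·a_j is a square in ℚ₃; (iii) there exist indices i and j such that 5·a_i is a square in ℚ₅ and 10·a_j is a square in ℚ₅; (iv) some a_i is odd. -/

import Mathlib

open Matrix

/-- A positive definite integral quadratic form of rank `m`. -/
def IsPDForm {m : ℕ} (M : Matrix (Fin m) (Fin m) ℤ) : Prop :=
  M.IsSymm ∧ ∀ x : Fin m → ℤ, x ≠ 0 → 0 < x ⬝ᵥ M.mulVec x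

/-- `N` is represented by `L` if `Tᵀ L T = N` for some integer matrix `T`. -/
def Represents {n m : ℕ} (L : Matrix (Fin n) (Fin n) ℤ)
    (N : Matrix (Fin m) (Fin m) ℤ) : Prop :=
  ∃ T : Matrix (Fin n) (Fin m) ℤ, Tᵀ * L * T = N

/-- An integer `a` is represented by the form `M`. -/
def RepresentsInt {m : ℕ} (M : Matrix (Fin m) (Fin m) ℤ) (a : ℤ) : Prop :=
  ∃ x : Fin m → ℤ, x ⬝ᵥ M.mulVec x = a

/-- Two integral forms of rank `n` are isometric. -/
def IsomForm {n : ℕ} (A B : Matrix (Fin n) (Fin n) ℤ) : Prop :=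
  ∃ U : Matrix (Fin n) (Fin n) ℤ, IsUnit U.det ∧ Uᵀ * A * U = B


instance : Fact (Nat.Prime 5) := ⟨by norm_num⟩


/-- A positive ternary form of determinant `d` representing `n`, whose adjoint represents `β`. -/
def TGood (d n β : ℤ) (a b c r s t : ℤ) : Prop :=
  0 < a ∧ 0 < a * b - t ^ 2 ∧
  a * b * c + 2 * r * s * t - a * r ^ 2 - b * s ^ 2 - c * t ^ 2 = d ∧
  (∃ x y z : ℤ, a * x ^ 2 + b * y ^ 2 + c * z ^ 2 + 2 * r * y * z + 2 * s * x * z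
    + 2 * t * x * y = n) ∧
  (∃ x y z : ℤ, (b * c - r ^ 2) * x ^ 2 + (a * c - s ^ 2) * y ^ 2 + (a * b - t ^ 2) * z ^ 2
    + 2 * (s * t - a * r) * y * z + 2 * (r * t - b * s) * x * z
    + 2 * (r * s - c * t) * x * y = β)

lemma TGood.swap12 {d n β a b c r s t : ℤ} (h : TGood d n β a b c r s t) :
    TGood d n β b a c s r t := by
  obtain ⟨h1, h2, h3, ⟨x, y, z, h4⟩, ⟨u, v, w, h5⟩⟩ := h
  refine ⟨?_, by linarith, by linarith, ⟨y, x, z, by linarith⟩, ⟨v, u, w, by linarith⟩⟩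
  have : 0 < a * b := by nlinarith [sq_nonneg t]
  exact (pos_iff_pos_of_mul_pos this).1 h1

lemma TGood.swap23 {d n β a b c r s t : ℤ} (hd : 0 < d) (h : TGood d n β a b c r s t) :
    TGood d n β a c b r t s := by
  obtain ⟨h1, h2, h3, ⟨x, y, z, h4⟩, ⟨u, v, w, h5⟩⟩ := h
  refine ⟨h1, ?_, by linarith, ⟨x, z, y, by linarith⟩, ⟨u, w, v, by linarith⟩⟩
  have key : (a * b - t ^ 2) * (a * c - s ^ 2) = a * d + (s * t - a * r) ^ 2 := by
    rw [← h3]; ring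
  have : 0 < (a * b - t ^ 2) * (a * c - s ^ 2) := by
    rw [key]; positivity
  exact (pos_iff_pos_of_mul_pos this).1 h2

lemma TGood.shear12 {d n β a b c r s t : ℤ} (k : ℤ) (h : TGood d n β a b c r s t) :
    TGood d n β a (b + 2 * k * t + k ^ 2 * a) c (r + k * s) s (t + k * a) := by
  obtain ⟨h1, h2, h3, ⟨x, y, z, h4⟩, ⟨u, v, w, h5⟩⟩ := h
  refine ⟨h1, by linarith, by rw [← h3]; ring, ⟨x - k * y, y, z, by rw [← h4]; ring⟩,
    ⟨u, v + k * u, w, by rw [← h5]; ring⟩⟩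

lemma TGood.shear13 {d n β a b c r s t : ℤ} (k : ℤ) (h : TGood d n β a b c r s t) :
    TGood d n β a b (c + 2 * k * s + k ^ 2 * a) (r + k * t) (s + k * a) t := by
  obtain ⟨h1, h2, h3, ⟨x, y, z, h4⟩, ⟨u, v, w, h5⟩⟩ := h
  refine ⟨h1, by linarith, by rw [← h3]; ring, ⟨x - k * z, y, z, by rw [← h4]; ring⟩,
    ⟨u, v, w + k * u, by rw [← h5]; ring⟩⟩

lemma TGood.shear23 {d n β a b c r s t : ℤ} (k : ℤ) (h : TGood d n β a b c r s t) :
    TGood d n β a b (c + 2 * k * r + k ^ 2 * b) (r + k * b) (s + k * t) t := by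
  obtain ⟨h1, h2, h3, ⟨x, y, z, h4⟩, ⟨u, v, w, h5⟩⟩ := h
  refine ⟨h1, by linarith, by rw [← h3]; ring, ⟨x, y - k * z, z, by rw [← h4]; ring⟩,
    ⟨u, v, w + k * v, by rw [← h5]; ring⟩⟩

lemma exists_round (t a : ℤ) (ha : 0 < a) : ∃ k : ℤ, 2 * (t + k * a) ≤ a ∧ -a ≤ 2 * (t + k * a) := by
  refine ⟨-((2 * t + a) / (2 * a)), ?_, ?_⟩
  · have := Int.emod_add_mul_ediv (2 * t + a) (2 * a)
    have h2 := Int.emod_lt_of_pos (2 * t + a) (by linarith : 0 < 2 * a)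
    nlinarith
  · have := Int.emod_add_mul_ediv (2 * t + a) (2 * a)
    have h2 := Int.emod_nonneg (2 * t + a) (by linarith : 2 * a ≠ 0)
    nlinarith

lemma TGood.reduce {d n β : ℤ} (hd : 0 < d) (h : ∃ a b c r s t, TGood d n β a b c r s t) :
    ∃ a b c r s t, TGood d n β a b c r s t ∧ 2 * t ≤ a ∧ -a ≤ 2 * t ∧ 2 * s ≤ a ∧ -a ≤ 2 * s ∧
      a ≤ b ∧ 2 * (s * t - a * r) ≤ a * b - t ^ 2 ∧ - (a * b - t ^ 2) ≤ 2 * (s * t - a * r) ∧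
      a * b - t ^ 2 ≤ a * c - s ^ 2 := by
  classical
  have hA : ∃ m : ℕ, ∃ a b c r s t, TGood d n β a b c r s t ∧ a.toNat = m := by
    obtain ⟨a, b, c, r, s, t, h⟩ := h
    exact ⟨_, a, b, c, r, s, t, h, rfl⟩
  obtain ⟨a0, hmin, hex⟩ : ∃ m : ℕ, (∀ a b c r s t, TGood d n β a b c r s t → m ≤ a.toNat) ∧
      ∃ a b c r s t, TGood d n β a b c r s t ∧ a.toNat = m :=
    ⟨Nat.find hA, fun a b c r s t hg => Nat.find_min' hA ⟨a, b, c, r, s, t, hg, rfl⟩,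
      Nat.find_spec hA⟩
  have hB : ∃ m : ℕ, ∃ a b c r s t, TGood d n β a b c r s t ∧ a.toNat = a0 ∧
      (a * b - t ^ 2).toNat = m := by
    obtain ⟨a, b, c, r, s, t, h, h'⟩ := hex
    exact ⟨_, a, b, c, r, s, t, h, h', rfl⟩
  obtain ⟨C0, hmin2, a, b, c, r, s, t, hg, ha, hC⟩ : ∃ m : ℕ,
      (∀ a b c r s t, TGood d n β a b c r s t → a.toNat = a0 → m ≤ (a * b - t ^ 2).toNat) ∧
      ∃ a b c r s t, TGood d n β a b c r s t ∧ a.toNat = a0 ∧ (a * b - t ^ 2).toNat = m :=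
    ⟨Nat.find hB, fun a b c r s t hg h' => Nat.find_min' hB ⟨a, b, c, r, s, t, hg, h', rfl⟩,
      Nat.find_spec hB⟩
  have ha0 := hg.1
  have hC0 := hg.2.1
  obtain ⟨k, hk1, hk2⟩ := exists_round (-(s * t - a * r)) _ hC0
  have g1 := hg.shear23 k
  obtain ⟨l, hl1, hl2⟩ := exists_round t _ ha0
  have g2 := g1.shear12 l
  obtain ⟨m, hm1, hm2⟩ := exists_round (s + k * t) _ ha0
  have g3 := g2.shear13 m
  refine ⟨_, _, _, _, _, _, g3, hl1, hl2, hm1, hm2, ?_, ?_, ?_, ?_⟩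
  · have := hmin _ _ _ _ _ _ g3.swap12
    have := g3.swap12.1
    omega
  · nlinarith
  · nlinarith
  · have h1 := hmin2 _ _ _ _ _ _ (g3.swap23 hd) ha
    have h2 := (g3.swap23 hd).2.1
    have h3 := g3.2.1
    have h4 : a * (b + 2 * l * t + l ^ 2 * a) - (t + l * a) ^ 2 = a * b - t ^ 2 := by ring
    rw [h4]
    omega

lemma TGood.bounds {d n β : ℤ} (hd : 0 < d) (h : ∃ a b c r s t, TGood d n β a b c r s t) :
    ∃ a b c r s t, TGood d n β a b c r s t ∧ 2 * t ≤ a ∧ -a ≤ 2 * t ∧ 2 * s ≤ a ∧ -a ≤ 2 * s ∧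
      a ≤ b ∧ 2 * (s * t - a * r) ≤ a * b - t ^ 2 ∧ - (a * b - t ^ 2) ≤ 2 * (s * t - a * r) ∧
      3 * a ^ 2 ≤ 4 * (a * b - t ^ 2) ∧ 3 * (a * b - t ^ 2) ^ 2 ≤ 4 * (a * d) ∧
      27 * a ^ 3 ≤ 64 * d := by
  obtain ⟨a, b, c, r, s, t, hg, h1, h2, h3, h4, h5, h6, h7, h8⟩ := TGood.reduce hd h
  have ha := hg.1
  have hC := hg.2.1
  have e1 : 3 * a ^ 2 ≤ 4 * (a * b - t ^ 2) := by nlinarith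
  have key : (a * b - t ^ 2) * (a * c - s ^ 2) = a * d + (s * t - a * r) ^ 2 := by
    rw [← hg.2.2.1]; ring
  have e2 : 3 * (a * b - t ^ 2) ^ 2 ≤ 4 * (a * d) := by nlinarith
  refine ⟨a, b, c, r, s, t, hg, h1, h2, h3, h4, h5, h6, h7, e1, e2, ?_⟩
  have e3 : (3 * a ^ 2) ^ 2 ≤ (4 * (a * b - t ^ 2)) ^ 2 := by
    apply pow_le_pow_left₀ (by positivity) e1
  have e4 : a * (27 * a ^ 3) ≤ a * (64 * d) := by nlinarith
  exact le_of_mul_le_mul_left e4 ha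

lemma TGood.final1 {n β : ℤ} (h : ∃ a b c r s t, TGood 1 n β a b c r s t) :
    ∃ x y z : ℤ, x ^ 2 + y ^ 2 + z ^ 2 = n := by
  obtain ⟨a, b, c, r, s, t, hg, h1, h2, h3, h4, h5, h6, h7, h8, h9, h10⟩ :=
    TGood.bounds (by norm_num) h
  have ha := hg.1
  have ha' : a = 1 := by
    have : a < 2 := by by_contra hh; push Not at hh; nlinarith [mul_self_nonneg a, sq_nonneg (a-2)]
    omega
  subst ha'
  have ht : t = 0 := by omega
  have hs : s = 0 := by omega
  subst ht hs
  have hb : b = 1 := by nlinarith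
  subst hb
  have hr : r = 0 := by omega
  subst hr
  obtain ⟨-, -, hd, ⟨x, y, z, hn⟩, -⟩ := hg
  have hc : c = 1 := by linarith
  subst hc
  exact ⟨x, y, z, by linarith⟩

lemma TGood.final3 {n β : ℤ} (hβ : β % 3 = 1) (h : ∃ a b c r s t, TGood 3 n β a b c r s t) :
    ∃ x y z : ℤ, x ^ 2 + y ^ 2 + 3 * z ^ 2 = n := by
  obtain ⟨a, b, c, r, s, t, hg, h1, h2, h3, h4, h5, h6, h7, h8, h9, h10⟩ :=
    TGood.bounds (by norm_num) h
  have ha := hg.1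
  have ha' : a = 1 := by
    have : a < 2 := by by_contra hh; push Not at hh; nlinarith [mul_self_nonneg a, sq_nonneg (a-2)]
    omega
  subst ha'
  have ht : t = 0 := by omega
  have hs : s = 0 := by omega
  subst ht hs
  have hb : b ≤ 2 := by nlinarith
  obtain ⟨-, -, hd, ⟨x, y, z, hn⟩, ⟨u, v, w, hb'⟩⟩ := hg
  obtain rfl | rfl : b = 1 ∨ b = 2 := by omega
  · have hr : r = 0 := by omega
    subst hr
    have hc : c = 3 := by linarith
    subst hc
    exact ⟨x, y, z, by linarith⟩
  · exfalso
    have key : ∀ u v w : ZMod 3, 3 * u ^ 2 + 2 * v ^ 2 + 2 * w ^ 2 - 2 * v * w ≠ 1 ∧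
        3 * u ^ 2 + 2 * v ^ 2 + 2 * w ^ 2 + 2 * v * w ≠ 1 := by decide
    have hβ' : ((β : ℤ) : ZMod 3) = 1 := by
      have : ((β : ℤ) : ZMod 3) = ((1 : ℤ) : ZMod 3) := by
        rw [ZMod.intCast_eq_intCast_iff]; exact hβ
      simpa using this
    obtain rfl | rfl | rfl : r = 0 ∨ r = 1 ∨ r = -1 := by omega
    · omega
    · have hc : c = 2 := by omega
      subst hc
      have : β = 3 * u ^ 2 + 2 * v ^ 2 + 2 * w ^ 2 - 2 * v * w := by linarith
      rw [this] at hβ'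
      push_cast at hβ'
      exact (key _ _ _).1 hβ'
    · have hc : c = 2 := by omega
      subst hc
      have : β = 3 * u ^ 2 + 2 * v ^ 2 + 2 * w ^ 2 + 2 * v * w := by linarith
      rw [this] at hβ'
      push_cast at hβ'
      exact (key _ _ _).2 hβ'

lemma TGood.final5 {n β : ℤ} (hβ : β % 5 = 2 ∨ β % 5 = 3)
    (h : ∃ a b c r s t, TGood 5 n β a b c r s t) :
    ∃ x y z : ℤ, x ^ 2 + 2 * y ^ 2 + 2 * y * z + 3 * z ^ 2 = n := by
  obtain ⟨a, b, c, r, s, t, hg, h1, h2, h3, h4, h5, h6, h7, h8, h9, h10⟩ :=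
    TGood.bounds (by norm_num) h
  have ha := hg.1
  have ha' : a < 3 := by
    by_contra hh; push Not at hh; nlinarith [mul_self_nonneg a, sq_nonneg (a-3)]
  obtain ⟨-, -, hd, ⟨x, y, z, hn⟩, ⟨u, v, w, hb'⟩⟩ := hg
  obtain rfl | rfl : a = 1 ∨ a = 2 := by omega
  · have ht : t = 0 := by omega
    have hs : s = 0 := by omega
    subst ht hs
    have hb : b ≤ 2 := by nlinarith
    obtain rfl | rfl : b = 1 ∨ b = 2 := by omega
    · exfalso
      have hr : r = 0 := by omega
      subst hr
      have hc : c = 5 := by linarith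
      subst hc
      have key : ∀ u v w : ZMod 5, 5 * u ^ 2 + 5 * v ^ 2 + w ^ 2 ≠ 2 ∧
        5 * u ^ 2 + 5 * v ^ 2 + w ^ 2 ≠ 3 := by decide
      have : β = 5 * u ^ 2 + 5 * v ^ 2 + w ^ 2 := by linarith
      have e : ((β : ℤ) : ZMod 5) = 5 * u ^ 2 + 5 * v ^ 2 + w ^ 2 := by rw [this]; push_cast; ring
      rcases hβ with hβ | hβ
      · have : ((β : ℤ) : ZMod 5) = ((2 : ℤ) : ZMod 5) := by
          rw [ZMod.intCast_eq_intCast_iff]; exact hβ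
        rw [e] at this
        exact (key _ _ _).1 (by simpa using this)
      · have : ((β : ℤ) : ZMod 5) = ((3 : ℤ) : ZMod 5) := by
          rw [ZMod.intCast_eq_intCast_iff]; exact hβ
        rw [e] at this
        exact (key _ _ _).2 (by simpa using this)
    · obtain rfl | rfl | rfl : r = 0 ∨ r = 1 ∨ r = -1 := by omega
      · omega
      · have hc : c = 3 := by omega
        subst hc
        exact ⟨x, y, z, by linarith⟩
      · have hc : c = 3 := by omega
        subst hc
        exact ⟨x, y, -z, by linarith⟩
  · exfalso
    have hC : 2 * b - t ^ 2 ≤ 3 := by nlinarith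
    obtain rfl | rfl | rfl : t = 0 ∨ t = 1 ∨ t = -1 := by omega
    · omega
    · have hb : b = 2 := by omega
      subst hb
      obtain rfl | rfl | rfl : s = 0 ∨ s = 1 ∨ s = -1 := by omega
      · obtain rfl : r = 0 := by omega
        omega
      · obtain rfl | rfl : r = 0 ∨ r = 1 := by omega
        all_goals omega
      · obtain rfl | rfl : r = 0 ∨ r = -1 := by omega
        all_goals omega
    · have hb : b = 2 := by omega
      subst hb
      obtain rfl | rfl | rfl : s = 0 ∨ s = 1 ∨ s = -1 := by omega
      · obtain rfl : r = 0 := by omega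
        omega
      · obtain rfl | rfl : r = 0 ∨ r = -1 := by omega
        all_goals omega
      · obtain rfl | rfl : r = 0 ∨ r = 1 := by omega
        all_goals omega

lemma TGood.mk_of {d n b g A : ℤ} (hA : 0 < A) (hb : 0 < b) (h : n * b = d + g ^ 2 * A)
    (hsq : ∃ t : ℤ, A ∣ t ^ 2 + b) : ∃ a b' c r s t, TGood d n b a b' c r s t := by
  obtain ⟨t, e, he⟩ := hsq
  have e1 : A * e - t ^ 2 = b := by linarith
  refine ⟨A, e, n, g, 0, t, hA, by linarith, ?_, ⟨0, 0, 1, by ring⟩, ⟨0, 0, 1, by linarith⟩⟩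
  have : n * (A * e - t ^ 2) = d + g ^ 2 * A := by rw [e1, h]
  linarith

open scoped NumberTheorySymbols

lemma sqmod_one {q b : ℕ} (hq : q.Prime) (h : J(-(b : ℤ) | q) = 1) :
    ∃ t : ℤ, (q : ℤ) ∣ t ^ 2 + b := by
  have : Fact q.Prime := ⟨hq⟩
  obtain ⟨x, hx⟩ := ZMod.isSquare_of_jacobiSym_eq_one h
  refine ⟨x.val, ?_⟩
  rw [← ZMod.intCast_zmod_eq_zero_iff_dvd]
  push_cast
  rw [ZMod.natCast_zmod_val]
  push_cast at hx
  linear_combination -hx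

lemma sqmod_two {q b : ℕ} (hq : q.Prime) (hq2 : q % 2 = 1) (hb : b % 2 = 1)
    (h : J(-(b : ℤ) | q) = 1) :
    ∃ t : ℤ, ((2 * q : ℕ) : ℤ) ∣ t ^ 2 + b := by
  obtain ⟨t, ht⟩ := sqmod_one hq h
  have key : ∀ t : ℤ, t % 2 = 1 → (q : ℤ) ∣ t ^ 2 + b → ((2 * q : ℕ) : ℤ) ∣ t ^ 2 + b := by
    intro t h1 h2
    push_cast
    apply IsCoprime.mul_dvd _ _ h2
    · rw [Int.isCoprime_iff_gcd_eq_one]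
      have : Nat.Coprime 2 q := by
        rw [Nat.coprime_two_left, Nat.odd_iff]; exact hq2
      exact_mod_cast this
    · obtain ⟨k, rfl⟩ : ∃ k, t = 2 * k + 1 := ⟨t / 2, by omega⟩
      have : (2 * k + 1) ^ 2 + (b : ℤ) = 2 * (2 * k ^ 2 + 2 * k) + (1 + b) := by ring
      rw [this]
      omega
  rcases Int.emod_two_eq_zero_or_one t with h1 | h1
  · refine ⟨t + q, key _ (by omega) ?_⟩
    have : (t + q) ^ 2 + (b : ℤ) = (t ^ 2 + b) + q * (2 * t + q) := by ring
    rw [this]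
    exact dvd_add ht (dvd_mul_right _ _)
  · exact ⟨t, key _ h1 ht⟩

lemma exists_bq {n0 D E N c r : ℕ} (h : n0 * c = D + E * r) (hcop : Nat.Coprime n0 D)
    (hr : Nat.Coprime r N) (hn : 0 < n0) (hN : 0 < N) :
    ∃ q k : ℕ, q.Prime ∧ 5 < q ∧ n0 * (c + E * N * k) = D + E * q := by
  have h1 : Nat.Coprime r n0 := by
    have h2 : Nat.gcd r n0 ∣ D := by
      have h3 : Nat.gcd r n0 ∣ D + E * r := by
        rw [← h]; exact Dvd.dvd.mul_right (Nat.gcd_dvd_right _ _) _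
      exact (Nat.dvd_add_left (Dvd.dvd.mul_left (Nat.gcd_dvd_left _ _) _)).1 h3
    have h3 : Nat.gcd r n0 ∣ Nat.gcd n0 D := Nat.dvd_gcd (Nat.gcd_dvd_right _ _) h2
    rw [hcop] at h3
    exact Nat.dvd_one.1 h3
  obtain ⟨q, hq1, hq2, hq3⟩ := Nat.forall_exists_prime_gt_and_modEq (r + 5) (q := N * n0) (a := r)
    (by positivity) (hr.mul_right h1)
  obtain ⟨k, hk⟩ := (Nat.modEq_iff_dvd' (by omega : r ≤ q)).1 hq3.symm
  have hq : q = r + N * n0 * k := by omega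
  refine ⟨q, k, hq2, by omega, ?_⟩
  rw [hq, mul_add, h]; ring

lemma jac_res (a : ℤ) {b N v : ℕ} (hb : b % 2 = 1) (hN : N = 4 * a.natAbs) (h : b % N = v) :
    J(a | b) = J(a | v) := by
  rw [jacobiSym.mod_right _ (Nat.odd_iff.2 hb), ← hN, h]

lemma jac_cong {n b d g κ q : ℕ} (h : n * b = d + g ^ 2 * (κ * q)) (hg : Nat.Coprime g b) :
    J((κ : ℤ) | b) * J((q : ℤ) | b) = J(-(d : ℤ) | b) := by
  have h1 : J(-(d : ℤ) | b) = J((g : ℤ) ^ 2 * (κ * q) | b) := by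
    apply jacobiSym.mod_left'
    apply Int.ModEq.symm
    apply (Int.modEq_iff_dvd).2
    refine ⟨-n, ?_⟩
    have : (n : ℤ) * b = d + g ^ 2 * (κ * q) := by exact_mod_cast h
    linarith
  rw [h1, jacobiSym.mul_left, jacobiSym.mul_left, jacobiSym.sq_one' (by exact_mod_cast hg), one_mul]

lemma jac_flip3 {b q : ℕ} (hb : b % 4 = 3) (hq : q % 2 = 1) : J(-(b : ℤ) | q) = J((q : ℤ) | b) := by
  have hqo : Odd q := Nat.odd_iff.2 hq
  rw [jacobiSym.neg _ hqo]
  rcases (by omega : q % 4 = 1 ∨ q % 4 = 3) with h | h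
  · rw [ZMod.χ₄_nat_one_mod_four h, one_mul,
      jacobiSym.quadratic_reciprocity_one_mod_four h (Nat.odd_iff.2 (by omega))]
  · rw [ZMod.χ₄_nat_three_mod_four h, jacobiSym.quadratic_reciprocity_three_mod_four h hb]; ring

lemma jac_flip1 {b q : ℕ} (hb : b % 4 = 1) (hq : q % 2 = 1) : J((b : ℤ) | q) = J((q : ℤ) | b) :=
  jacobiSym.quadratic_reciprocity_one_mod_four hb (Nat.odd_iff.2 hq)

/-- Case `b ≡ 3 (mod 4)`, `κ = 1`. -/
lemma jac_case1 {n b d g q : ℕ} (h : n * b = d + g ^ 2 * (1 * q)) (hg : Nat.Coprime g b)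
    (hb : b % 4 = 3) (hq : q % 2 = 1) (hd : J(-(d : ℤ) | b) = 1) : J(-(b : ℤ) | q) = 1 := by
  rw [jac_flip3 hb hq, ← hd, ← jac_cong h hg]; simp

lemma jac_case2 {n b d g q : ℕ} (h : n * b = d + g ^ 2 * (2 * q)) (hg : Nat.Coprime g b)
    (hb : b % 8 = 7) (hq : q % 2 = 1) (hd : J(-(d : ℤ) | b) = 1) : J(-(b : ℤ) | q) = 1 := by
  have h2 : J(((2 : ℕ) : ℤ) | b) = 1 := by
    rw [Nat.cast_ofNat, jac_res 2 (by omega) rfl hb]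
    norm_num
  rw [jac_flip3 (by omega) hq, ← hd, ← jac_cong h hg, h2, one_mul]

lemma jac_case3 {n b d g q : ℕ} (h : n * (2 * b) = d + g ^ 2 * (1 * q)) (hg : Nat.Coprime g b)
    (hb : b % 4 = 1) (hq : q % 2 = 1) (hd : J(-2 | q) * J(-(d : ℤ) | b) = 1) :
    J(-((2 * b : ℕ) : ℤ) | q) = 1 := by
  have h' : (n * 2) * b = d + g ^ 2 * (1 * q) := by rw [← h]; ring
  have e : (-((2 * b : ℕ) : ℤ)) = (-2) * (b : ℤ) := by push_cast; ring
  rw [e, jacobiSym.mul_left, jac_flip1 hb hq, ← hd, ← jac_cong h' hg]; simp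

lemma jac_neg3 {b : ℕ} (h : b % 12 = 7) : J(-(3 : ℤ) | b) = 1 := by
  rw [jac_res _ (by omega) rfl h]
  norm_num

lemma jac_neg3' {b : ℕ} (h : b % 12 = 5) : J(-(3 : ℤ) | b) = -1 := by
  rw [jac_res _ (by omega) rfl h]
  norm_num

lemma jac_neg5 {b : ℕ} (h : b % 20 = 7 ∨ b % 20 = 3 ∨ b % 20 = 1 ∨ b % 20 = 9) :
    J(-(5 : ℤ) | b) = 1 := by
  rcases h with h | h | h | h <;> rw [jac_res _ (by omega) rfl h] <;> norm_num

lemma jac_neg2 {q : ℕ} (h : q % 8 = 1) : J(-2 | q) = 1 := by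
  rw [jac_res _ (by omega) rfl h]
  norm_num

lemma jac_neg2' {q : ℕ} (h : q % 8 = 7) : J(-2 | q) = -1 := by
  rw [jac_res _ (by omega) rfl h]
  norm_num

lemma cop3 {b : ℕ} (h : b % 3 ≠ 0) : Nat.Coprime 3 b :=
  (Nat.Prime.coprime_iff_not_dvd Nat.prime_three).2 (by omega)

lemma cop5 {b : ℕ} (h : b % 5 ≠ 0) : Nat.Coprime 5 b :=
  (Nat.Prime.coprime_iff_not_dvd Nat.prime_five).2 (by omega)

lemma cop2 {b : ℕ} (h : b % 2 ≠ 0) : Nat.Coprime b 2 :=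
  ((Nat.Prime.coprime_iff_not_dvd Nat.prime_two).2 (by omega)).symm

lemma cop_pow2 {b : ℕ} (h : b % 2 ≠ 0) (k : ℕ) : Nat.Coprime b (2 ^ k) := (cop2 h).pow_right k

lemma three_squares_core (n : ℕ) (h4 : n % 4 ≠ 0) (h7 : n % 8 ≠ 7) :
    ∃ x y z : ℤ, x ^ 2 + y ^ 2 + z ^ 2 = n := by
  rcases (by omega : n % 2 = 0 ∨ n % 4 = 1 ∨ n % 8 = 3) with h | h | h
  · obtain ⟨q, k, hq, hq5, e⟩ := exists_bq (n0 := n) (D := 1) (E := 1) (N := 4) (c := 1)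
      (r := n - 1) (by omega) (by simp) (cop_pow2 (by omega) 2) (by omega) (by omega)
    have e1 : n * (4 * k) = 4 * (n * k) := by ring
    have e2 : n + n * (4 * k) = 1 + q := by rw [← one_mul q, ← e]; ring
    apply TGood.final1 (β := ((1 + 1 * 4 * k : ℕ) : ℤ))
    apply TGood.mk_of (g := 1) (A := q) (by exact_mod_cast hq.pos) (by positivity)
    · have : (n : ℤ) * ((1 + 1 * 4 * k : ℕ) : ℤ) = ((1 + 1 * q : ℕ) : ℤ) := by exact_mod_cast e
      rw [this]; push_cast; ring
    · apply sqmod_one hq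
      rw [jacobiSym.neg _ (Nat.odd_iff.2 (by omega)), ZMod.χ₄_nat_one_mod_four (by omega), one_mul,
        jac_flip1 (by omega) (by omega)]
      have := jac_cong (n := n) (b := 1 + 1 * 4 * k) (d := 1) (g := 1) (κ := 1) (q := q)
        (by rw [e]; ring) (by simp)
      rw [Nat.cast_one, jacobiSym.one_left, one_mul] at this
      rw [this, jacobiSym.at_neg_one (Nat.odd_iff.2 (by omega)),
        ZMod.χ₄_nat_one_mod_four (by omega)]
  · obtain ⟨q, k, hq, hq5, e⟩ := exists_bq (n0 := n) (D := 1) (E := 2) (N := 4) (c := 3)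
      (r := (3 * n - 1) / 2) (by omega) (by simp) (cop_pow2 (by omega) 2) (by omega) (by omega)
    have e2 : 3 * n + 8 * (n * k) = 1 + 2 * q := by rw [← e]; ring
    apply TGood.final1 (β := ((3 + 2 * 4 * k : ℕ) : ℤ))
    apply TGood.mk_of (g := 1) (A := ((2 * q : ℕ) : ℤ)) (by exact_mod_cast (by omega))
      (by positivity)
    · have : (n : ℤ) * ((3 + 2 * 4 * k : ℕ) : ℤ) = ((1 + 2 * q : ℕ) : ℤ) := by exact_mod_cast e
      rw [this]; push_cast; ring
    · apply sqmod_two hq (by omega) (by omega)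
      rw [jac_flip3 (by omega) (by omega)]
      have := jac_cong (n := n) (b := 3 + 2 * 4 * k) (d := 1) (g := 1) (κ := 2) (q := q)
        (by rw [e]; ring) (by simp)
      rw [Nat.cast_one, jacobiSym.at_neg_one (Nat.odd_iff.2 (by omega)),
        ZMod.χ₄_nat_three_mod_four (by omega), Nat.cast_ofNat,
        jacobiSym.mod_right 2 (Nat.odd_iff.2 (by omega))] at this
      have h8 : (3 + 2 * 4 * k) % (4 * (2 : ℤ).natAbs) = 3 := by
        change _ % 8 = _; omega
      have h9 : J(2 | 3) = -1 := by norm_num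
      rw [h8, h9] at this
      linarith
  · obtain ⟨q, k, hq, hq5, e⟩ := exists_bq (n0 := n) (D := 1) (E := 2) (N := 4) (c := 1)
      (r := (1 * n - 1) / 2) (by omega) (by simp) (cop_pow2 (by omega) 2) (by omega) (by omega)
    have e2 : 1 * n + 8 * (n * k) = 1 + 2 * q := by rw [← e]; ring
    apply TGood.final1 (β := ((1 + 2 * 4 * k : ℕ) : ℤ))
    apply TGood.mk_of (g := 1) (A := ((2 * q : ℕ) : ℤ)) (by exact_mod_cast (by omega))
      (by positivity)
    · have : (n : ℤ) * ((1 + 2 * 4 * k : ℕ) : ℤ) = ((1 + 2 * q : ℕ) : ℤ) := by exact_mod_cast e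
      rw [this]; push_cast; ring
    · apply sqmod_two hq (by omega) (by omega)
      rw [jacobiSym.neg _ (Nat.odd_iff.2 (by omega)), ZMod.χ₄_nat_one_mod_four (by omega), one_mul,
        jac_flip1 (by omega) (by omega)]
      have := jac_cong (n := n) (b := 1 + 2 * 4 * k) (d := 1) (g := 1) (κ := 2) (q := q)
        (by rw [e]; ring) (by simp)
      rw [Nat.cast_one, jacobiSym.at_neg_one (Nat.odd_iff.2 (by omega)),
        ZMod.χ₄_nat_one_mod_four (by omega), Nat.cast_ofNat,
        jacobiSym.mod_right 2 (Nat.odd_iff.2 (by omega))] at this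
      have h8 : (1 + 2 * 4 * k) % (4 * (2 : ℤ).natAbs) = 1 := by
        change _ % 8 = _; omega
      rw [h8, jacobiSym.one_right, one_mul] at this
      exact this

/-- Packaging: a prime `q` with the right symbol produces the required ternary form. -/
lemma TGood.of_one {n b d g q : ℕ} (hb : 0 < b) (hq : q.Prime)
    (h : n * b = d + g ^ 2 * (1 * q)) (hJ : J(-(b : ℤ) | q) = 1) :
    ∃ a b' c r s t, TGood d n b a b' c r s t := by
  apply TGood.mk_of (g := g) (A := q) (by exact_mod_cast hq.pos) (by exact_mod_cast hb)
  · have : (n : ℤ) * b = d + g ^ 2 * (1 * q) := by exact_mod_cast h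
    rw [this]; ring
  · exact sqmod_one hq hJ

lemma TGood.of_two {n b d g q : ℕ} (hb : b % 2 = 1) (hq : q.Prime) (hq2 : q % 2 = 1)
    (h : n * b = d + g ^ 2 * (2 * q)) (hJ : J(-(b : ℤ) | q) = 1) :
    ∃ a b' c r s t, TGood d n b a b' c r s t := by
  apply TGood.mk_of (g := g) (A := ((2 * q : ℕ) : ℤ)) (by have := hq.pos; exact_mod_cast (by omega))
    (by exact_mod_cast (by omega))
  · exact_mod_cast h
  · exact sqmod_two hq hq2 hb hJ

lemma odd_of_prime_gt {q : ℕ} (hq : q.Prime) (h : 5 < q) : q % 2 = 1 := by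
  rcases hq.eq_two_or_odd with h' | h' <;> omega

/-- From `n b = d + g² κ q`, with `κ = 1`, `b ≡ 3 (mod 4)`. -/
lemma TGood.route1 {n b d g q : ℕ} (hq : q.Prime) (hq5 : 5 < q)
    (h : n * b = d + g ^ 2 * (1 * q)) (hg : Nat.Coprime g b)
    (hb : b % 4 = 3) (hd : J(-(d : ℤ) | b) = 1) :
    ∃ a b' c r s t, TGood d n b a b' c r s t :=
  TGood.of_one (by omega) hq h (jac_case1 h hg hb (odd_of_prime_gt hq hq5) hd)

lemma TGood.route2 {n b d g q : ℕ} (hq : q.Prime) (hq5 : 5 < q)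
    (h : n * b = d + g ^ 2 * (2 * q)) (hg : Nat.Coprime g b)
    (hb : b % 8 = 7) (hd : J(-(d : ℤ) | b) = 1) :
    ∃ a b' c r s t, TGood d n b a b' c r s t :=
  TGood.of_two (by omega) hq (odd_of_prime_gt hq hq5) h
    (jac_case2 h hg hb (odd_of_prime_gt hq hq5) hd)

lemma TGood.route3 {n b d g q : ℕ} (hq : q.Prime) (hq5 : 5 < q)
    (h : n * (2 * b) = d + g ^ 2 * (1 * q)) (hg : Nat.Coprime g b)
    (hb : b % 4 = 1) (hd : J(-2 | q) * J(-(d : ℤ) | b) = 1) :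
    ∃ a b' c r s t, TGood d n ((2 * b : ℕ) : ℤ) a b' c r s t :=
  TGood.of_one (by omega) hq h (jac_case3 h hg hb (odd_of_prime_gt hq hq5) hd)

lemma form3_core (n : ℕ) (h4 : n % 4 ≠ 0) (h9 : n % 9 ≠ 0) (h6 : n % 9 ≠ 6) :
    ∃ x y z : ℤ, x ^ 2 + y ^ 2 + 3 * z ^ 2 = n := by
  by_cases hn3 : n % 3 = 0
  · obtain ⟨m, rfl⟩ : ∃ m, n = 3 * m := ⟨n / 3, by omega⟩
    rcases (by omega : m % 2 = 0 ∨ m % 4 = 1 ∨ m % 4 = 3) with h | h | h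
    · obtain ⟨q, k, hq, hq5, e⟩ := exists_bq (n0 := m) (D := 1) (E := 3) (N := 4) (c := 7)
        (r := (7 * m - 1) / 3) (by omega) (by simp) (cop_pow2 (by omega) 2) (by omega) (by omega)
      apply TGood.final3 (β := ((7 + 3 * 4 * k : ℕ) : ℤ)) (by omega)
      exact TGood.route1 (d := 3) (g := 3) hq hq5 (by rw [mul_assoc, e]; ring) (cop3 (by omega))
        (by omega) (jac_neg3 (by omega))
    · obtain ⟨q, k, hq, hq5, e⟩ := exists_bq (n0 := m) (D := 1) (E := 6) (N := 4) (c := 7)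
        (r := (7 * m - 1) / 6) (by omega) (by simp) (cop_pow2 (by omega) 2) (by omega) (by omega)
      apply TGood.final3 (β := ((7 + 6 * 4 * k : ℕ) : ℤ)) (by omega)
      exact TGood.route2 (d := 3) (g := 3) hq hq5 (by rw [mul_assoc, e]; ring) (cop3 (by omega))
        (by omega) (jac_neg3 (by omega))
    · obtain ⟨q, k, hq, hq5, e⟩ := exists_bq (n0 := m) (D := 1) (E := 3) (N := 8) (c := 10)
        (r := (10 * m - 1) / 3) (by omega) (by simp) (cop_pow2 (by omega) 3) (by omega) (by omega)
      have e2 : 10 * m + 24 * (m * k) = 1 + 3 * q := by rw [← e]; ring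
      have e3 : 10 + 3 * 8 * k = 2 * (5 + 12 * k) := by ring
      rw [e3] at e
      apply TGood.final3 (β := ((2 * (5 + 12 * k) : ℕ) : ℤ)) (by omega)
      exact TGood.route3 (d := 3) (g := 3) hq hq5 (by rw [mul_assoc, e]; ring) (cop3 (by omega))
        (by omega) (by
          rw [jac_neg2' (by omega)]
          have := jac_neg3' (b := 5 + 12 * k) (by omega)
          rw [Nat.cast_ofNat, this]; rfl)
  · have hc : Nat.Coprime n 3 := (cop3 hn3).symm
    rcases (by omega : n % 2 = 0 ∨ n % 4 = 3 ∨ n % 4 = 1) with h | h | h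
    · obtain ⟨q, k, hq, hq5, e⟩ := exists_bq (n0 := n) (D := 3) (E := 1) (N := 2 ^ 2 * 3) (c := 7)
        (r := (7 * n - 3)) (by omega) hc
        ((cop_pow2 (by omega) 2).mul_right (cop3 (by omega)).symm) (by omega) (by omega)
      apply TGood.final3 (β := ((7 + 1 * (2 ^ 2 * 3) * k : ℕ) : ℤ)) (by omega)
      exact TGood.route1 (d := 3) (g := 1) hq hq5 (by rw [e]; ring) (by simp)
        (by omega) (jac_neg3 (by omega))
    · obtain ⟨q, k, hq, hq5, e⟩ := exists_bq (n0 := n) (D := 3) (E := 2) (N := 2 ^ 2 * 3) (c := 7)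
        (r := (7 * n - 3) / 2) (by omega) hc
        ((cop_pow2 (by omega) 2).mul_right (cop3 (by omega)).symm) (by omega) (by omega)
      apply TGood.final3 (β := ((7 + 2 * (2 ^ 2 * 3) * k : ℕ) : ℤ)) (by omega)
      exact TGood.route2 (d := 3) (g := 1) hq hq5 (by rw [e]; ring) (by simp)
        (by omega) (jac_neg3 (by omega))
    · obtain ⟨q, k, hq, hq5, e⟩ := exists_bq (n0 := n) (D := 3) (E := 1) (N := 2 ^ 3 * 3) (c := 10)
        (r := (10 * n - 3)) (by omega) hc
        ((cop_pow2 (by omega) 3).mul_right (cop3 (by omega)).symm) (by omega) (by omega)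
      have e2 : 10 * n + 24 * (n * k) = 3 + q := by rw [← one_mul q, ← e]; ring
      have e3 : 10 + 1 * (2 ^ 3 * 3) * k = 2 * (5 + 12 * k) := by ring
      rw [e3] at e
      apply TGood.final3 (β := ((2 * (5 + 12 * k) : ℕ) : ℤ)) (by omega)
      exact TGood.route3 (d := 3) (g := 1) hq hq5 (by rw [e]; ring) (by simp)
        (by omega) (by
          rw [jac_neg2' (by omega)]
          have := jac_neg3' (b := 5 + 12 * k) (by omega)
          rw [Nat.cast_ofNat, this]; rfl)

/-- The part of the proof for the determinant-five form in which `5 ∣ n`, `n = 5 m`. -/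
lemma form5_div (m : ℕ) (h4 : m % 4 ≠ 0) (c1 c2 c3 : ℕ)
    (h1 : c1 % 20 = 7 ∨ c1 % 20 = 3) (h2 : c2 % 40 = 7 ∨ c2 % 40 = 23)
    (h3 : c3 % 20 = 1 ∨ c3 % 20 = 9) (hm1 : (m * c1) % 5 = 1) (hm2 : (m * c2) % 5 = 1)
    (hm3 : (m * (2 * c3)) % 5 = 1) :
    ∃ x y z : ℤ, x ^ 2 + 2 * y ^ 2 + 2 * y * z + 3 * z ^ 2 = ((5 * m : ℕ) : ℤ) := by
  rcases (by omega : m % 2 = 0 ∨ m % 4 = 1 ∨ m % 4 = 3) with h | h | h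
  · have hodd : (m * c1) % 2 = 0 := by rw [Nat.mul_mod, h]; simp
    obtain ⟨q, k, hq, hq5, e⟩ := exists_bq (n0 := m) (D := 1) (E := 5) (N := 4) (c := c1)
      (r := (m * c1 - 1) / 5) (by omega) (by simp) (cop_pow2 (by omega) 2) (by omega) (by omega)
    apply TGood.final5 (β := ((c1 + 5 * 4 * k : ℕ) : ℤ)) (by omega)
    exact TGood.route1 (d := 5) (g := 5) hq hq5 (by rw [mul_assoc, e]; ring) (cop5 (by omega))
      (by omega) (jac_neg5 (by omega))
  · have hodd : (m * c2) % 4 = 3 := by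
      rw [Nat.mul_mod, h, (by omega : c2 % 4 = 3)]
    obtain ⟨q, k, hq, hq5, e⟩ := exists_bq (n0 := m) (D := 1) (E := 10) (N := 4) (c := c2)
      (r := (m * c2 - 1) / 10) (by omega) (by simp) (cop_pow2 (by omega) 2) (by omega) (by omega)
    apply TGood.final5 (β := ((c2 + 10 * 4 * k : ℕ) : ℤ)) (by omega)
    exact TGood.route2 (d := 5) (g := 5) hq hq5 (by rw [mul_assoc, e]; ring) (cop5 (by omega))
      (by omega) (jac_neg5 (by omega))
  · have hodd : (m * c3) % 4 = 3 := by
      rw [Nat.mul_mod, h, (by omega : c3 % 4 = 1)]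
    have hh : m * (2 * c3) = 2 * (m * c3) := by ring
    obtain ⟨q, k, hq, hq5, e⟩ := exists_bq (n0 := m) (D := 1) (E := 5) (N := 8) (c := 2 * c3)
      (r := (m * (2 * c3) - 1) / 5) (by omega) (by simp) (cop_pow2 (by omega) 3) (by omega)
      (by omega)
    have e2 : 2 * (m * c3) + 40 * (m * k) = 1 + 5 * q := by rw [← e]; ring
    have e3 : 2 * c3 + 5 * 8 * k = 2 * (c3 + 20 * k) := by ring
    rw [e3] at e
    apply TGood.final5 (β := ((2 * (c3 + 20 * k) : ℕ) : ℤ)) (by omega)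
    exact TGood.route3 (d := 5) (g := 5) hq hq5 (by rw [mul_assoc, e]; ring) (cop5 (by omega))
      (by omega) (by
        rw [jac_neg2 (by omega)]
        have := jac_neg5 (b := c3 + 20 * k) (by omega)
        rw [Nat.cast_ofNat, this]; rfl)

lemma form5_core (n : ℕ) (h4 : n % 4 ≠ 0) (h25 : n % 25 ≠ 0) (h5 : n % 25 ≠ 5)
    (h20 : n % 25 ≠ 20) :
    ∃ x y z : ℤ, x ^ 2 + 2 * y ^ 2 + 2 * y * z + 3 * z ^ 2 = n := by
  by_cases hn5 : n % 5 = 0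
  · obtain ⟨m, rfl⟩ : ∃ m, n = 5 * m := ⟨n / 5, by omega⟩
    rcases (by omega : m % 5 = 2 ∨ m % 5 = 3) with h | h
    · exact form5_div m (by omega) 3 23 9 (by omega) (by omega) (by omega) (by omega) (by omega)
        (by omega)
    · exact form5_div m (by omega) 7 7 1 (by omega) (by omega) (by omega) (by omega) (by omega)
        (by omega)
  · have hc : Nat.Coprime n 5 := (cop5 hn5).symm
    rcases (by omega : n % 2 = 0 ∨ n % 4 = 1 ∨ n % 4 = 3) with h | h | h
    · obtain ⟨q, k, hq, hq5, e⟩ := exists_bq (n0 := n) (D := 5) (E := 1) (N := 2 ^ 2 * 5) (c := 7)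
        (r := (7 * n - 5)) (by omega) hc
        ((cop_pow2 (by omega) 2).mul_right (cop5 (by omega)).symm) (by omega) (by omega)
      apply TGood.final5 (β := ((7 + 1 * (2 ^ 2 * 5) * k : ℕ) : ℤ)) (by omega)
      exact TGood.route1 (d := 5) (g := 1) hq hq5 (by rw [e]; ring) (by simp)
        (by omega) (jac_neg5 (by omega))
    · obtain ⟨q, k, hq, hq5, e⟩ := exists_bq (n0 := n) (D := 5) (E := 2) (N := 2 ^ 2 * 5) (c := 7)
        (r := (7 * n - 5) / 2) (by omega) hc
        ((cop_pow2 (by omega) 2).mul_right (cop5 (by omega)).symm) (by omega) (by omega)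
      apply TGood.final5 (β := ((7 + 2 * (2 ^ 2 * 5) * k : ℕ) : ℤ)) (by omega)
      exact TGood.route2 (d := 5) (g := 1) hq hq5 (by rw [e]; ring) (by simp)
        (by omega) (jac_neg5 (by omega))
    · obtain ⟨q, k, hq, hq5, e⟩ := exists_bq (n0 := n) (D := 5) (E := 1) (N := 2 ^ 3 * 5) (c := 2)
        (r := (2 * n - 5)) (by omega) hc
        ((cop_pow2 (by omega) 3).mul_right (cop5 (by omega)).symm) (by omega) (by omega)
      have e2 : 2 * n + 40 * (n * k) = 5 + q := by rw [← one_mul q, ← e]; ring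
      have e3 : 2 + 1 * (2 ^ 3 * 5) * k = 2 * (1 + 20 * k) := by ring
      rw [e3] at e
      apply TGood.final5 (β := ((2 * (1 + 20 * k) : ℕ) : ℤ)) (by omega)
      exact TGood.route3 (d := 5) (g := 1) hq hq5 (by rw [e]; ring) (by simp)
        (by omega) (by
          rw [jac_neg2 (by omega)]
          have := jac_neg5 (b := 1 + 20 * k) (by omega)
          rw [Nat.cast_ofNat, this]; rfl)

lemma padic_sq_of_hensel (p : ℕ) [Fact p.Prime] (u : ℕ)
    (h : ‖((u : ℤ_[p]) - 1)‖ < ‖(2 : ℤ_[p])‖ ^ 2) : IsSquare (u : ℚ_[p]) := by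
  have := hensels_lemma (p := p) (R := ℤ_[p]) (F := (Polynomial.X ^ 2 - Polynomial.C (u : ℤ_[p])))
    (a := 1) (by
      simpa [Polynomial.derivative_pow, norm_sub_rev] using h)
  obtain ⟨z, hz, -⟩ := this
  refine ⟨(z : ℚ_[p]), ?_⟩
  have h1 : z ^ 2 = (u : ℤ_[p]) := by
    simpa [sub_eq_zero] using hz
  have h2 : ((z ^ 2 : ℤ_[p]) : ℚ_[p]) = ((u : ℤ_[p]) : ℚ_[p]) := by rw [h1]
  push_cast at h2
  rw [← h2, pow_two]

lemma sq_two {u : ℕ} (h : u % 8 = 1) : IsSquare (u : ℚ_[2]) := by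
  apply padic_sq_of_hensel
  obtain ⟨k, rfl⟩ : ∃ k, u = 8 * k + 1 := ⟨u / 8, by omega⟩
  have e : (((8 * k + 1 : ℕ) : ℤ_[2]) - 1) = 2 ^ 3 * (k : ℤ_[2]) := by push_cast; ring
  have h2 : ‖(2 : ℤ_[2])‖ = 2⁻¹ := by
    have := PadicInt.norm_p (p := 2); simpa using this
  rw [e, norm_mul, norm_pow, h2]
  have := PadicInt.norm_le_one (k : ℤ_[2])
  norm_num
  linarith

lemma sq_three {u : ℕ} (h : u % 3 = 1) : IsSquare (u : ℚ_[3]) := by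
  apply padic_sq_of_hensel
  obtain ⟨k, rfl⟩ : ∃ k, u = 3 * k + 1 := ⟨u / 3, by omega⟩
  have e : (((3 * k + 1 : ℕ) : ℤ_[3]) - 1) = 3 * (k : ℤ_[3]) := by push_cast; ring
  have h3 : ‖(3 : ℤ_[3])‖ = 3⁻¹ := by
    have := PadicInt.norm_p (p := 3); simpa using this
  have h2 : ‖(2 : ℤ_[3])‖ = 1 := by
    have := (PadicInt.norm_natCast_eq_one_iff (p := 3) (n := 2)).2 (by norm_num); simpa using this
  rw [e, norm_mul, h3, h2]
  have := PadicInt.norm_le_one (k : ℤ_[3])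
  norm_num
  linarith

lemma sq_five_one {u : ℕ} (h : u % 5 = 1) : IsSquare (u : ℚ_[5]) := by
  apply padic_sq_of_hensel
  obtain ⟨k, rfl⟩ : ∃ k, u = 5 * k + 1 := ⟨u / 5, by omega⟩
  have e : (((5 * k + 1 : ℕ) : ℤ_[5]) - 1) = 5 * (k : ℤ_[5]) := by push_cast; ring
  have h3 : ‖(5 : ℤ_[5])‖ = 5⁻¹ := by
    have := PadicInt.norm_p (p := 5); simpa using this
  have h2 : ‖(2 : ℤ_[5])‖ = 1 := by
    have := (PadicInt.norm_natCast_eq_one_iff (p := 5) (n := 2)).2 (by norm_num); simpa using this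
  rw [e, norm_mul, h3, h2]
  have := PadicInt.norm_le_one (k : ℤ_[5])
  norm_num
  linarith

/-- `c * x` square and `c * e = c' * w ^ 2`-type relations transfer squares. -/
lemma sq_transfer {K : Type*} [Field K] {c c' x : K} (hc : c ≠ 0) (h : IsSquare (c * c'))
    (hx : IsSquare (c * x)) : IsSquare (c' * x) := by
  obtain ⟨u, hu⟩ := h
  obtain ⟨v, hv⟩ := hx
  refine ⟨u * v / c, ?_⟩
  field_simp
  linear_combination (c * x) * hu + u ^ 2 * hv

lemma sq_five {u : ℕ} (h : u % 5 = 1 ∨ u % 5 = 4) : IsSquare (u : ℚ_[5]) := by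
  rcases h with h | h
  · exact sq_five_one h
  · have h1 : IsSquare ((4 * u : ℕ) : ℚ_[5]) := sq_five_one (by omega)
    have := sq_transfer (c := (4 : ℚ_[5])) (c' := 1) (x := u) (by norm_num) ⟨2, by norm_num⟩
      (by exact_mod_cast h1)
    simpa using this

/-- Reduction to the squarefree case. -/
lemma sqfree_reduce {n : ℕ} (hn : 0 < n) : ∃ s m : ℕ, n = m ^ 2 * s ∧ 0 < m ∧ s % 4 ≠ 0 ∧
    s % 9 ≠ 0 ∧ s % 25 ≠ 0 := by
  obtain ⟨s, m, hs, hm, e, hsq⟩ := Nat.sq_mul_squarefree_of_pos hn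
  have key : ∀ k : ℕ, 1 < k → s % (k * k) ≠ 0 := by
    intro k hk h
    have := hsq k (Nat.dvd_of_mod_eq_zero h)
    rw [Nat.isUnit_iff] at this
    omega
  exact ⟨s, m, e.symm, hm, key 2 (by norm_num), key 3 (by norm_num), key 5 (by norm_num)⟩

lemma sq_mul_sq {p : ℕ} [Fact p.Prime] {c : ℚ_[p]} {m s : ℕ} (h : IsSquare (c * (s : ℚ_[p]))) :
    IsSquare (c * ((m ^ 2 * s : ℕ) : ℚ_[p])) := by
  have : c * ((m ^ 2 * s : ℕ) : ℚ_[p]) = (m : ℚ_[p]) * m * (c * s) := by push_cast; ring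
  rw [this]
  exact IsSquare.mul ⟨m, rfl⟩ h

lemma F1 {n : ℕ} (hn : 0 < n) (h : ¬ IsSquare ((7 : ℚ_[2]) * n)) :
    ∃ x y z : ℤ, x ^ 2 + y ^ 2 + z ^ 2 = n := by
  obtain ⟨s, m, rfl, hm, h4, -, -⟩ := sqfree_reduce hn
  have h7 : s % 8 ≠ 7 := by
    intro h7
    apply h (sq_mul_sq _)
    have := sq_two (u := 7 * s) (by omega)
    exact_mod_cast this
  obtain ⟨x, y, z, e⟩ := three_squares_core s h4 h7
  exact ⟨m * x, m * y, m * z, by push_cast; rw [← e]; ring⟩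

lemma F8 {n : ℕ} (hn : 0 < n) (h : ¬ IsSquare ((6 : ℚ_[3]) * n)) :
    ∃ x y z : ℤ, x ^ 2 + y ^ 2 + 3 * z ^ 2 = n := by
  obtain ⟨s, m, rfl, hm, h4, h9, -⟩ := sqfree_reduce hn
  have h7 : s % 9 ≠ 6 := by
    intro h7
    apply h (sq_mul_sq _)
    obtain ⟨k, rfl⟩ : ∃ k, s = 9 * k + 6 := ⟨s / 9, by omega⟩
    have := sq_three (u := 6 * k + 4) (by omega)
    have h2 : (6 : ℚ_[3]) * ((9 * k + 6 : ℕ) : ℚ_[3]) = 3 * 3 * ((6 * k + 4 : ℕ) : ℚ_[3]) := by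
      push_cast; ring
    rw [h2]
    exact IsSquare.mul ⟨3, rfl⟩ this
  obtain ⟨x, y, z, e⟩ := form3_core s h4 h9 h7
  exact ⟨m * x, m * y, m * z, by push_cast; rw [← e]; ring⟩

lemma F10 {n : ℕ} (hn : 0 < n) (h : ¬ IsSquare ((5 : ℚ_[5]) * n)) :
    ∃ x y z : ℤ, x ^ 2 + 2 * y ^ 2 + 2 * y * z + 3 * z ^ 2 = n := by
  obtain ⟨s, m, rfl, hm, h4, -, h25⟩ := sqfree_reduce hn
  have h7 : ¬ (s % 25 = 5 ∨ s % 25 = 20) := by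
    intro h7
    apply h (sq_mul_sq _)
    obtain ⟨k, rfl⟩ : ∃ k, s = 5 * k := ⟨s / 5, by omega⟩
    have := sq_five (u := k) (by omega)
    have h2 : (5 : ℚ_[5]) * ((5 * k : ℕ) : ℚ_[5]) = 5 * 5 * (k : ℚ_[5]) := by
      push_cast; ring
    rw [h2]
    exact IsSquare.mul ⟨5, rfl⟩ this
  obtain ⟨x, y, z, e⟩ := form5_core s h4 h25 (by tauto) (by tauto)
  exact ⟨m * x, m * y, m * z, by push_cast; rw [← e]; ring⟩

/-- Change of multiplier: if `c * m` and `c' * n` differ by a square then they are squares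
simultaneously. -/
lemma sq_two_transfer {c c' k n : ℕ} (hc : 0 < c * k) {w u : ℕ} (hw : c * k * c' = w ^ 2 * u)
    (hu : u % 8 = 1) (h : ¬ IsSquare ((c' : ℚ_[2]) * n)) :
    ¬ IsSquare ((c : ℚ_[2]) * ((k * n : ℕ) : ℚ_[2])) := by
  intro hs
  apply h
  apply sq_transfer (c := ((c * k : ℕ) : ℚ_[2])) (by exact_mod_cast hc.ne')
  · have : ((c * k : ℕ) : ℚ_[2]) * (c' : ℚ_[2]) = (w : ℚ_[2]) * w * u := by
      have : ((c * k * c' : ℕ) : ℚ_[2]) = ((w ^ 2 * u : ℕ) : ℚ_[2]) := by rw [hw]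
      push_cast at this ⊢
      rw [this]; ring
    rw [this]
    exact IsSquare.mul ⟨w, rfl⟩ (sq_two hu)
  · have e : ((c * k : ℕ) : ℚ_[2]) * n = (c : ℚ_[2]) * ((k * n : ℕ) : ℚ_[2]) := by
      push_cast; ring
    rw [e]; exact hs

lemma F2 {n : ℕ} (hn : 0 < n) (h : ¬ IsSquare ((14 : ℚ_[2]) * n)) :
    ∃ x y z : ℤ, x ^ 2 + y ^ 2 + 2 * z ^ 2 = n := by
  obtain ⟨a, b, c, e⟩ := F1 (n := 2 * n) (by omega)
    (sq_two_transfer (c := 7) (c' := 14) (k := 2) (w := 14) (u := 1) (by norm_num) (by norm_num)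
      (by norm_num) h)
  push_cast at e
  have key : ∀ a b c : ℤ, c % 2 = 0 → a ^ 2 + b ^ 2 + c ^ 2 = 2 * n →
      ∃ x y z : ℤ, x ^ 2 + y ^ 2 + 2 * z ^ 2 = n := by
    intro a b c hc e
    obtain ⟨c', rfl⟩ : ∃ c', c = 2 * c' := ⟨c / 2, by omega⟩
    have hab : (a + b) % 2 = 0 := by
      have e2 : (a + b) * (a + b) = 2 * (n + a * b - 2 * c' ^ 2) := by linarith
      have e3 : (a + b) * (a + b) % 2 = 0 := by omega
      rcases Int.emod_two_eq_zero_or_one (a + b) with h | h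
      · exact h
      · rw [Int.mul_emod, h] at e3; norm_num at e3
    obtain ⟨k, rfl⟩ : ∃ k, a = 2 * k - b := ⟨(a + b) / 2, by omega⟩
    exact ⟨k, k - b, c', by linarith⟩
  have hpar : a % 2 = 0 ∨ b % 2 = 0 ∨ c % 2 = 0 := by
    by_contra hh
    push Not at hh
    obtain ⟨a', rfl⟩ : ∃ k, a = 2 * k + 1 := ⟨a / 2, by omega⟩
    obtain ⟨b', rfl⟩ : ∃ k, b = 2 * k + 1 := ⟨b / 2, by omega⟩
    obtain ⟨c', rfl⟩ : ∃ k, c = 2 * k + 1 := ⟨c / 2, by omega⟩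
    have : 2 * (2 * a' ^ 2 + 2 * a' + 2 * b' ^ 2 + 2 * b' + 2 * c' ^ 2 + 2 * c' + 1 - n) + 1 = 0 := by
      linarith
    omega
  rcases hpar with h | h | h
  · exact key b c a h (by linarith)
  · exact key a c b h (by linarith)
  · exact key a b c h e

lemma zmod_cast_dvd {p : ℕ} {a : ℤ} (h : ((a : ℤ) : ZMod p) = 0) : (p : ℤ) ∣ a :=
  (ZMod.intCast_zmod_eq_zero_iff_dvd a p).1 h

lemma F3 {n : ℕ} (hn : 0 < n) (h : ¬ IsSquare ((3 : ℚ_[2]) * n)) :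
    ∃ x y z : ℤ, x ^ 2 + y ^ 2 + 5 * z ^ 2 = n := by
  obtain ⟨a, b, c, e⟩ := F1 (n := 5 * n) (by omega)
    (sq_two_transfer (c := 7) (c' := 3) (k := 5) (w := 1) (u := 105) (by norm_num) (by norm_num)
      (by norm_num) h)
  push_cast at e
  have key : ∀ u v w : ℤ, (5 : ℤ) ∣ w → (5 : ℤ) ∣ u - 2 * v → u ^ 2 + v ^ 2 + w ^ 2 = 5 * n →
      ∃ x y z : ℤ, x ^ 2 + y ^ 2 + 5 * z ^ 2 = n := by
    rintro u v w ⟨z, rfl⟩ ⟨y, hy⟩ e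
    obtain rfl : u = 2 * v + 5 * y := by linarith
    exact ⟨2 * y + v, y, z, by linarith⟩
  have dec : ∀ u v w : ZMod 5, u ^ 2 + v ^ 2 + w ^ 2 = 0 →
      (w = 0 ∧ (u - 2 * v = 0 ∨ -u - 2 * v = 0)) ∨ (u = 0 ∧ (v - 2 * w = 0 ∨ -v - 2 * w = 0)) ∨
      (v = 0 ∧ (u - 2 * w = 0 ∨ -u - 2 * w = 0)) := by decide
  have hz : ((a : ZMod 5)) ^ 2 + (b : ZMod 5) ^ 2 + (c : ZMod 5) ^ 2 = 0 := by
    have : (((a ^ 2 + b ^ 2 + c ^ 2 : ℤ)) : ZMod 5) = ((5 * n : ℤ) : ZMod 5) := by rw [e]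
    push_cast at this
    rw [this, (by decide : (5 : ZMod 5) = 0), zero_mul]
  rcases dec _ _ _ hz with ⟨h1, h2 | h2⟩ | ⟨h1, h2 | h2⟩ | ⟨h1, h2 | h2⟩
  · exact key a b c (zmod_cast_dvd h1) (zmod_cast_dvd (by push_cast; exact h2)) e
  · exact key (-a) b c (zmod_cast_dvd h1) (zmod_cast_dvd (by push_cast; exact h2)) (by linarith)
  · exact key b c a (zmod_cast_dvd h1) (zmod_cast_dvd (by push_cast; exact h2)) (by linarith)
  · exact key (-b) c a (zmod_cast_dvd h1) (zmod_cast_dvd (by push_cast; exact h2)) (by linarith)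
  · exact key a c b (zmod_cast_dvd h1) (zmod_cast_dvd (by push_cast; exact h2)) (by linarith)
  · exact key (-a) c b (zmod_cast_dvd h1) (zmod_cast_dvd (by push_cast; exact h2)) (by linarith)

lemma F4 {n : ℕ} (hn : 0 < n) (h : ¬ IsSquare ((10 : ℚ_[2]) * n)) :
    ∃ x y z : ℤ, x ^ 2 + 2 * y ^ 2 + 3 * z ^ 2 = n := by
  obtain ⟨a, b, c, e⟩ := F1 (n := 6 * n) (by omega)
    (sq_two_transfer (c := 7) (c' := 10) (k := 6) (w := 2) (u := 105) (by norm_num) (by norm_num)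
      (by norm_num) h)
  push_cast at e
  have key : ∀ a b c : ℤ, (6 : ℤ) ∣ b - a → (6 : ℤ) ∣ c - 2 * a → a ^ 2 + b ^ 2 + c ^ 2 = 6 * n →
      ∃ x y z : ℤ, x ^ 2 + 2 * y ^ 2 + 3 * z ^ 2 = n := by
    rintro a b c ⟨u, hu⟩ ⟨v, hv⟩ e
    obtain rfl : b = a + 6 * u := by linarith
    obtain rfl : c = 2 * a + 6 * v := by linarith
    exact ⟨a + u + 2 * v, u - v, -u, by linarith⟩
  have key2 : ∀ a b c : ℤ, ((6 : ℤ) ∣ b - a ∨ (6 : ℤ) ∣ -b - a) →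
      ((6 : ℤ) ∣ c - 2 * a ∨ (6 : ℤ) ∣ -c - 2 * a) → a ^ 2 + b ^ 2 + c ^ 2 = 6 * n →
      ∃ x y z : ℤ, x ^ 2 + 2 * y ^ 2 + 3 * z ^ 2 = n := by
    rintro a b c (h1 | h1) (h2 | h2) e
    · exact key a b c h1 h2 e
    · exact key a b (-c) h1 h2 (by linarith)
    · exact key a (-b) c h1 h2 (by linarith)
    · exact key a (-b) (-c) h1 h2 (by linarith)
  have dec : ∀ u v w : ZMod 6, u ^ 2 + v ^ 2 + w ^ 2 = 0 →
      ((v - u = 0 ∨ -v - u = 0) ∧ (w - 2 * u = 0 ∨ -w - 2 * u = 0)) ∨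
      ((w - u = 0 ∨ -w - u = 0) ∧ (v - 2 * u = 0 ∨ -v - 2 * u = 0)) ∨
      ((w - v = 0 ∨ -w - v = 0) ∧ (u - 2 * v = 0 ∨ -u - 2 * v = 0)) := by decide
  have hz : ((a : ZMod 6)) ^ 2 + (b : ZMod 6) ^ 2 + (c : ZMod 6) ^ 2 = 0 := by
    have : (((a ^ 2 + b ^ 2 + c ^ 2 : ℤ)) : ZMod 6) = ((6 * n : ℤ) : ZMod 6) := by rw [e]
    push_cast at this
    rw [this, (by decide : (6 : ZMod 6) = 0), zero_mul]
  have tr : ∀ u v k : ℤ, (((u : ZMod 6) - k * v = 0) ∨ (-(u : ZMod 6) - k * v = 0)) →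
      ((6 : ℤ) ∣ u - k * v ∨ (6 : ℤ) ∣ -u - k * v) := by
    rintro u v k (h | h)
    · exact Or.inl (zmod_cast_dvd (by push_cast; exact h))
    · exact Or.inr (zmod_cast_dvd (by push_cast; exact h))
  have tr1 : ∀ u v : ℤ, (((u : ZMod 6) - v = 0) ∨ (-(u : ZMod 6) - v = 0)) →
      ((6 : ℤ) ∣ u - v ∨ (6 : ℤ) ∣ -u - v) := by
    intro u v h
    have := tr u v 1 (by simpa using h)
    simpa using this
  rcases dec _ _ _ hz with ⟨h1, h2⟩ | ⟨h1, h2⟩ | ⟨h1, h2⟩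
  · exact key2 a b c (tr1 _ _ h1) (tr _ _ 2 (by exact_mod_cast h2)) e
  · exact key2 a c b (tr1 _ _ h1) (tr _ _ 2 (by exact_mod_cast h2)) (by linarith)
  · exact key2 b c a (tr1 _ _ h1) (tr _ _ 2 (by exact_mod_cast h2)) (by linarith)

lemma eis {x z : ℤ} (h : x % 2 = z % 2) : ∃ x' z' : ℤ, x ^ 2 + 3 * z ^ 2 = 4 * x' ^ 2 + 12 * z' ^ 2 := by
  rcases Int.emod_two_eq_zero_or_one x with hx | hx
  · obtain ⟨a, rfl⟩ : ∃ k, x = 2 * k := ⟨x / 2, by omega⟩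
    obtain ⟨b, rfl⟩ : ∃ k, z = 2 * k := ⟨z / 2, by omega⟩
    exact ⟨a, b, by ring⟩
  · rcases (by omega : (x - z) % 4 = 0 ∨ (x + z) % 4 = 0) with h4 | h4
    · obtain ⟨k, rfl⟩ : ∃ k, x = z + 4 * k := ⟨(x - z) / 4, by omega⟩
      exact ⟨k + z, k, by ring⟩
    · obtain ⟨k, rfl⟩ : ∃ k, x = -z + 4 * k := ⟨(x + z) / 4, by omega⟩
      exact ⟨k - z, k, by ring⟩

lemma sq_emod_two (x : ℤ) : x ^ 2 % 2 = x % 2 := by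
  rcases Int.emod_two_eq_zero_or_one x with h | h <;> simp [pow_two, Int.mul_emod, h]

lemma F5 {n : ℕ} (hn : 0 < n) (h : ¬ IsSquare ((5 : ℚ_[2]) * n)) :
    ∃ x y z : ℤ, x ^ 2 + 2 * y ^ 2 + 6 * z ^ 2 = n := by
  obtain ⟨a, b, c, e⟩ := F4 (n := 2 * n) (by omega)
    (sq_two_transfer (c := 10) (c' := 5) (k := 2) (w := 10) (u := 1) (by norm_num) (by norm_num)
      (by norm_num) h)
  push_cast at e
  obtain ⟨x, z, hxz⟩ := eis (x := a) (z := c) (by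
    have := sq_emod_two a
    have := sq_emod_two c
    omega)
  exact ⟨b, x, z, by linarith⟩

lemma F6 {n : ℕ} (hn : 0 < n) (h : ¬ IsSquare ((1 : ℚ_[2]) * n)) :
    ∃ x y z : ℤ, 2 * x ^ 2 + 7 * y ^ 2 + 7 * z ^ 2 + 4 * x * y + 6 * x * z = n := by
  obtain ⟨a, b, c, e⟩ := F1 (n := 7 * n) (by omega)
    (sq_two_transfer (c := 7) (c' := 1) (k := 7) (w := 7) (u := 1) (by norm_num) (by norm_num)
      (by norm_num) (by simpa using h))
  push_cast at e
  have key : ∀ a b c : ℤ, (7 : ℤ) ∣ b - 2 * a → (7 : ℤ) ∣ c - 3 * a →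
      a ^ 2 + b ^ 2 + c ^ 2 = 7 * n →
      ∃ x y z : ℤ, 2 * x ^ 2 + 7 * y ^ 2 + 7 * z ^ 2 + 4 * x * y + 6 * x * z = n := by
    rintro a b c ⟨u, hu⟩ ⟨v, hv⟩ e
    obtain rfl : b = 2 * a + 7 * u := by linarith
    obtain rfl : c = 3 * a + 7 * v := by linarith
    exact ⟨a, u, v, by linarith⟩
  have key2 : ∀ a b c : ℤ, ((7 : ℤ) ∣ b - 2 * a ∨ (7 : ℤ) ∣ -b - 2 * a) →
      ((7 : ℤ) ∣ c - 3 * a ∨ (7 : ℤ) ∣ -c - 3 * a) → a ^ 2 + b ^ 2 + c ^ 2 = 7 * n →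
      ∃ x y z : ℤ, 2 * x ^ 2 + 7 * y ^ 2 + 7 * z ^ 2 + 4 * x * y + 6 * x * z = n := by
    rintro a b c (h1 | h1) (h2 | h2) e
    · exact key a b c h1 h2 e
    · exact key a b (-c) h1 h2 (by linarith)
    · exact key a (-b) c h1 h2 (by linarith)
    · exact key a (-b) (-c) h1 h2 (by linarith)
  have dec : ∀ u v w : ZMod 7, u ^ 2 + v ^ 2 + w ^ 2 = 0 →
      ((v - 2 * u = 0 ∨ -v - 2 * u = 0) ∧ (w - 3 * u = 0 ∨ -w - 3 * u = 0)) ∨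
      ((w - 2 * u = 0 ∨ -w - 2 * u = 0) ∧ (v - 3 * u = 0 ∨ -v - 3 * u = 0)) := by decide
  have hz : ((a : ZMod 7)) ^ 2 + (b : ZMod 7) ^ 2 + (c : ZMod 7) ^ 2 = 0 := by
    have : (((a ^ 2 + b ^ 2 + c ^ 2 : ℤ)) : ZMod 7) = ((7 * n : ℤ) : ZMod 7) := by rw [e]
    push_cast at this
    rw [this, (by decide : (7 : ZMod 7) = 0), zero_mul]
  have tr : ∀ u v k : ℤ, (((u : ZMod 7) - k * v = 0) ∨ (-(u : ZMod 7) - k * v = 0)) →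
      ((7 : ℤ) ∣ u - k * v ∨ (7 : ℤ) ∣ -u - k * v) := by
    rintro u v k (h | h)
    · exact Or.inl (zmod_cast_dvd (by push_cast; exact h))
    · exact Or.inr (zmod_cast_dvd (by push_cast; exact h))
  rcases dec _ _ _ hz with ⟨h1, h2⟩ | ⟨h1, h2⟩
  · exact key2 a b c (tr _ _ 2 (by exact_mod_cast h1)) (tr _ _ 3 (by exact_mod_cast h2)) e
  · exact key2 a c b (tr _ _ 2 (by exact_mod_cast h1)) (tr _ _ 3 (by exact_mod_cast h2))
      (by linarith)

lemma F7 {n : ℕ} (hn : 0 < n) (h : ¬ IsSquare ((2 : ℚ_[2]) * n)) :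
    ∃ x y z : ℤ, x ^ 2 + 7 * y ^ 2 + 7 * z ^ 2 + 2 * x * y + 4 * x * z = n := by
  obtain ⟨a, b, c, e⟩ := F2 (n := 7 * n) (by omega)
    (sq_two_transfer (c := 14) (c' := 2) (k := 7) (w := 14) (u := 1) (by norm_num) (by norm_num)
      (by norm_num) h)
  push_cast at e
  have key : ∀ a b c : ℤ, (7 : ℤ) ∣ b - 1 * a → (7 : ℤ) ∣ c - 2 * a →
      2 * a ^ 2 + b ^ 2 + c ^ 2 = 7 * n →
      ∃ x y z : ℤ, x ^ 2 + 7 * y ^ 2 + 7 * z ^ 2 + 2 * x * y + 4 * x * z = n := by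
    rintro a b c ⟨u, hu⟩ ⟨v, hv⟩ e
    obtain rfl : b = a + 7 * u := by linarith
    obtain rfl : c = 2 * a + 7 * v := by linarith
    exact ⟨a, u, v, by linarith⟩
  have key2 : ∀ a b c : ℤ, ((7 : ℤ) ∣ b - 1 * a ∨ (7 : ℤ) ∣ -b - 1 * a) →
      ((7 : ℤ) ∣ c - 2 * a ∨ (7 : ℤ) ∣ -c - 2 * a) → 2 * a ^ 2 + b ^ 2 + c ^ 2 = 7 * n →
      ∃ x y z : ℤ, x ^ 2 + 7 * y ^ 2 + 7 * z ^ 2 + 2 * x * y + 4 * x * z = n := by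
    rintro a b c (h1 | h1) (h2 | h2) e
    · exact key a b c h1 h2 e
    · exact key a b (-c) h1 h2 (by linarith)
    · exact key a (-b) c h1 h2 (by linarith)
    · exact key a (-b) (-c) h1 h2 (by linarith)
  have dec : ∀ u v w : ZMod 7, v ^ 2 + w ^ 2 + 2 * u ^ 2 = 0 →
      ((v - 1 * u = 0 ∨ -v - 1 * u = 0) ∧ (w - 2 * u = 0 ∨ -w - 2 * u = 0)) ∨
      ((w - 1 * u = 0 ∨ -w - 1 * u = 0) ∧ (v - 2 * u = 0 ∨ -v - 2 * u = 0)) := by decide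
  have hz : ((a : ZMod 7)) ^ 2 + (b : ZMod 7) ^ 2 + 2 * (c : ZMod 7) ^ 2 = 0 := by
    have : (((a ^ 2 + b ^ 2 + 2 * c ^ 2 : ℤ)) : ZMod 7) = ((7 * n : ℤ) : ZMod 7) := by rw [e]
    push_cast at this
    rw [this, (by decide : (7 : ZMod 7) = 0), zero_mul]
  have tr : ∀ u v k : ℤ, (((u : ZMod 7) - k * v = 0) ∨ (-(u : ZMod 7) - k * v = 0)) →
      ((7 : ℤ) ∣ u - k * v ∨ (7 : ℤ) ∣ -u - k * v) := by
    rintro u v k (h | h)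
    · exact Or.inl (zmod_cast_dvd (by push_cast; exact h))
    · exact Or.inr (zmod_cast_dvd (by push_cast; exact h))
  rcases dec _ _ _ hz with ⟨h1, h2⟩ | ⟨h1, h2⟩
  · exact key2 c a b (tr _ _ 1 (by exact_mod_cast h1)) (tr _ _ 2 (by exact_mod_cast h2))
      (by linarith)
  · exact key2 c b a (tr _ _ 1 (by exact_mod_cast h1)) (tr _ _ 2 (by exact_mod_cast h2))
      (by linarith)

lemma F9 {n : ℕ} (hn : 0 < n) (h : ¬ IsSquare ((3 : ℚ_[3]) * n)) :
    ∃ x y z : ℤ, x ^ 2 + y ^ 2 + 6 * z ^ 2 = n := by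
  obtain ⟨a, b, c, e⟩ := F8 (n := 2 * n) (by omega) (by
    intro hs
    apply h
    have : IsSquare ((4 : ℚ_[3]) * (3 * n)) := by
      have e : (4 : ℚ_[3]) * (3 * n) = 6 * ((2 * n : ℕ) : ℚ_[3]) := by push_cast; ring
      rw [e]; exact hs
    have := sq_transfer (c := (4 : ℚ_[3])) (c' := 1) (by norm_num) ⟨2, by norm_num⟩ this
    simpa using this)
  push_cast at e
  have pa := sq_emod_two a
  have pb := sq_emod_two b
  have pc := sq_emod_two c
  have key : ∀ a b c : ℤ, a % 2 = c % 2 → b % 2 = 0 → a ^ 2 + b ^ 2 + 3 * c ^ 2 = 2 * n →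
      ∃ x y z : ℤ, x ^ 2 + y ^ 2 + 6 * z ^ 2 = n := by
    intro a b c h1 h2 e
    obtain ⟨x, z, hxz⟩ := eis h1
    obtain ⟨k, rfl⟩ : ∃ k, b = 2 * k := ⟨b / 2, by omega⟩
    exact ⟨x + k, x - k, z, by linarith⟩
  by_cases hc : c % 2 = 0
  · obtain ⟨z, rfl⟩ : ∃ k, c = 2 * k := ⟨c / 2, by omega⟩
    obtain ⟨k, rfl⟩ : ∃ k, a = b + 2 * k := ⟨(a - b) / 2, by omega⟩
    exact ⟨b + k, k, z, by linarith⟩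
  · by_cases hb : b % 2 = 0
    · exact key a b c (by omega) hb e
    · exact key b a c (by omega) (by omega) (by linarith)

lemma F11 {n : ℕ} (hn : 0 < n) (h : ¬ IsSquare ((10 : ℚ_[5]) * n)) :
    ∃ x y z : ℤ, x ^ 2 + 2 * y ^ 2 + 5 * z ^ 2 = n := by
  rcases (by omega : n % 2 = 0 ∨ n % 2 = 1) with hp | hp
  · obtain ⟨m, rfl⟩ : ∃ m, n = 2 * m := ⟨n / 2, by omega⟩
    obtain ⟨x, y, z, e⟩ := F10 (n := m) (by omega) (by
      intro hs
      apply h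
      have e : (10 : ℚ_[5]) * ((2 * m : ℕ) : ℚ_[5]) = 2 * 2 * (5 * m) := by push_cast; ring
      rw [e]
      exact IsSquare.mul ⟨2, rfl⟩ hs)
    push_cast
    exact ⟨2 * y + z, x, z, by linarith⟩
  · obtain ⟨x, y, z, e⟩ := F10 (n := 2 * n) (by omega) (by
      intro hs
      apply h
      have e : (10 : ℚ_[5]) * n = 5 * ((2 * n : ℕ) : ℚ_[5]) := by push_cast; ring
      rw [e]
      exact hs)
    push_cast at e
    have px := sq_emod_two x
    have pz := sq_emod_two z
    have hxz : (x - z) % 2 = 0 := by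
      have : x ^ 2 + 2 * (y ^ 2 + y * z) + 3 * z ^ 2 = 2 * n := by linarith
      omega
    obtain ⟨w, rfl⟩ : ∃ k, x = z + 2 * k := ⟨(x - z) / 2, by omega⟩
    have e2 : y * (y + z) + 2 * (z ^ 2 + z * w + w ^ 2) = n := by linarith
    have hz : z % 2 = 0 := by
      by_contra hz
      have : (y * (y + z)) % 2 = 0 := by
        rcases Int.emod_two_eq_zero_or_one y with h | h
        · rw [Int.mul_emod, h]; simp
        · rw [Int.mul_emod, (by omega : (y + z) % 2 = 0)]; simp
      omega
    obtain ⟨z', rfl⟩ : ∃ k, z = 2 * k := ⟨z / 2, by omega⟩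
    exact ⟨y + z', w + z', z', by linarith⟩

/-- The Gram matrix of a ternary form. -/
def tgram (a b c r s t : ℤ) : Matrix (Fin 3) (Fin 3) ℤ := !![a, t, s; t, b, r; s, r, c]

lemma tgram_eval (a b c r s t : ℤ) (x : Fin 3 → ℤ) :
    x ⬝ᵥ (tgram a b c r s t).mulVec x = a * x 0 ^ 2 + b * x 1 ^ 2 + c * x 2 ^ 2 + 2 * r * x 1 * x 2
      + 2 * s * x 0 * x 2 + 2 * t * x 0 * x 1 := by
  simp [tgram, Matrix.mulVec, dotProduct, Fin.sum_univ_three]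
  ring

lemma tgram_pd {a b c r s t : ℤ} (h1 : 0 < a) (h2 : 0 < a * b - t ^ 2)
    (h3 : 0 < a * b * c + 2 * r * s * t - a * r ^ 2 - b * s ^ 2 - c * t ^ 2) :
    IsPDForm (tgram a b c r s t) := by
  constructor
  · ext i j
    fin_cases i <;> fin_cases j <;> rfl
  · intro x hx
    rw [tgram_eval]
    set X := x 0 with hX
    set Y := x 1 with hY
    set Z := x 2 with hZ
    have key : a * (a * b - t ^ 2) * (a * X ^ 2 + b * Y ^ 2 + c * Z ^ 2 + 2 * r * Y * Z
        + 2 * s * X * Z + 2 * t * X * Y) = (a * b - t ^ 2) * (a * X + t * Y + s * Z) ^ 2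
        + ((a * b - t ^ 2) * Y + (a * r - s * t) * Z) ^ 2
        + a * (a * b * c + 2 * r * s * t - a * r ^ 2 - b * s ^ 2 - c * t ^ 2) * Z ^ 2 := by ring
    have hpos : 0 < a * (a * b - t ^ 2) := mul_pos h1 h2
    have hpos2 := mul_pos h1 h3
    refine pos_of_mul_pos_right (a := a * (a * b - t ^ 2)) ?_ hpos.le
    rw [key]
    by_cases hz : Z = 0
    · rw [hz]
      by_cases hy : Y = 0
      · have hx0 : X ≠ 0 := by
          intro h0
          apply hx
          ext i
          fin_cases i
          · exact h0
          · exact hy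
          · exact hz
        rw [hy]
        have : 0 < (a * b - t ^ 2) * (a * X) ^ 2 := by positivity
        linarith
      · have e1 : 0 ≤ (a * b - t ^ 2) * (a * X + t * Y + s * 0) ^ 2 := by positivity
        have e2 : 0 < ((a * b - t ^ 2) * Y) ^ 2 := by
          have := h2.ne'
          positivity
        linarith
    · have e1 : 0 ≤ (a * b - t ^ 2) * (a * X + t * Y + s * Z) ^ 2 := by positivity
      have e2 : 0 < a * (a * b * c + 2 * r * s * t - a * r ^ 2 - b * s ^ 2 - c * t ^ 2) * Z ^ 2 := by
        positivity
      have e3 := sq_nonneg ((a * b - t ^ 2) * Y + (a * r - s * t) * Z)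
      linarith

lemma no_form {v : Fin 7 → ℕ}
    (h : ¬ ∃ M : Matrix (Fin 3) (Fin 3) ℤ, IsPDForm M ∧ ∀ i, RepresentsInt M (v i : ℤ))
    (a b c r s t : ℤ) (h1 : 0 < a) (h2 : 0 < a * b - t ^ 2)
    (h3 : 0 < a * b * c + 2 * r * s * t - a * r ^ 2 - b * s ^ 2 - c * t ^ 2)
    {P : Fin 7 → Prop}
    (hrep : ∀ i, ¬ P i → ∃ x y z : ℤ, a * x ^ 2 + b * y ^ 2 + c * z ^ 2 + 2 * r * y * z
      + 2 * s * x * z + 2 * t * x * y = v i) : ∃ i, P i := by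
  by_contra hP
  push Not at hP
  apply h
  refine ⟨tgram a b c r s t, tgram_pd h1 h2 h3, fun i => ?_⟩
  obtain ⟨x, y, z, e⟩ := hrep i (hP i)
  refine ⟨![x, y, z], ?_⟩
  rw [tgram_eval, ← e]
  rfl

/-- The classes of `ℚ₂` modulo squares; the last one is the class of `6`. -/
def cls : Fin 8 → ℕ := ![1, 2, 3, 5, 7, 10, 14, 6]

lemma not_sq_two {N : ℕ} (h : ¬ IsSquare (N : ZMod (2 ^ 6))) : ¬ IsSquare (N : ℚ_[2]) := by
  rintro ⟨x, hx⟩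
  apply h
  have hn : ‖x‖ ≤ 1 := by
    have h1 : ‖x‖ * ‖x‖ ≤ 1 := by
      rw [← norm_mul, ← hx]
      have := Padic.norm_int_le_one (p := 2) (N : ℤ)
      simpa using this
    by_contra hh
    push Not at hh
    nlinarith
  obtain ⟨y, rfl⟩ : ∃ y : ℤ_[2], (y : ℚ_[2]) = x := ⟨⟨x, hn⟩, rfl⟩
  have e : (N : ℤ_[2]) = y * y := by
    apply PadicInt.ext
    rw [PadicInt.coe_natCast, PadicInt.coe_mul]
    exact hx
  refine ⟨PadicInt.toZModPow 6 y, ?_⟩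
  have := congrArg (PadicInt.toZModPow (p := 2) 6) e
  rw [map_natCast, map_mul] at this
  exact this

lemma cls_not_sq : ∀ i j : Fin 8, i ≠ j → ¬ IsSquare ((cls i * cls j : ℕ) : ZMod (2 ^ 6)) := by
  decide +kernel

lemma cls_ne {i j : Fin 8} (h : i ≠ j) : ¬ IsSquare ((cls i : ℚ_[2]) * (cls j : ℚ_[2])) := by
  have := not_sq_two (cls_not_sq i j h)
  rwa [Nat.cast_mul] at this

lemma cls_pos (i : Fin 8) : (cls i : ℚ_[2]) ≠ 0 := by
  have : cls i ≠ 0 := by revert i; decide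
  exact_mod_cast this

/-- If two classes both match `x`, they agree. -/
lemma cls_inj {i j : Fin 8} {x : ℚ_[2]} (hx : x ≠ 0) (h1 : IsSquare ((cls i : ℚ_[2]) * x))
    (h2 : IsSquare ((cls j : ℚ_[2]) * x)) : i = j := by
  by_contra hij
  apply cls_ne hij
  rw [mul_comm] at h1 h2
  have := sq_transfer hx h1 h2
  exact this

/-- Necessary conditions on seven positive integers not simultaneously representable
by any positive definite integral ternary quadratic form. -/
theorem conditions_on_seven_integers (a : Fin 7 → ℕ) (ha : ∀ i, 0 < a i)
    (h : ¬ ∃ M : Matrix (Fin 3) (Fin 3) ℤ, IsPDForm M ∧ ∀ i, RepresentsInt M (a i : ℤ)) :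
    (∀ i j, i ≠ j → ¬ IsSquare ((a i : ℚ_[2]) * (a j : ℚ_[2]))) ∧
    (∀ i, ¬ IsSquare ((6 : ℚ_[2]) * (a i : ℚ_[2]))) ∧
    (∃ i j, IsSquare ((3 : ℚ_[3]) * (a i : ℚ_[3])) ∧ IsSquare ((6 : ℚ_[3]) * (a j : ℚ_[3]))) ∧
    (∃ i j, IsSquare ((5 : ℚ_[5]) * (a i : ℚ_[5])) ∧ IsSquare ((10 : ℚ_[5]) * (a j : ℚ_[5]))) ∧
    (∃ i, Odd (a i)) := by
  have hne : ∀ i, (a i : ℚ_[2]) ≠ 0 := fun i => by exact_mod_cast (ha i).ne'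
  have hcl : ∀ k : Fin 7, ∃ i, IsSquare ((cls k.castSucc : ℚ_[2]) * (a i : ℚ_[2])) := by
    have c1 : ∃ i, IsSquare ((1 : ℚ_[2]) * (a i : ℚ_[2])) :=
      no_form h 2 7 7 0 3 2 (by norm_num) (by norm_num) (by norm_num) (fun i hi => by
        obtain ⟨x, y, z, e⟩ := F6 (ha i) hi
        exact ⟨x, y, z, by linarith⟩)
    have c2 : ∃ i, IsSquare ((2 : ℚ_[2]) * (a i : ℚ_[2])) :=
      no_form h 1 7 7 0 2 1 (by norm_num) (by norm_num) (by norm_num) (fun i hi => by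
        obtain ⟨x, y, z, e⟩ := F7 (ha i) hi
        exact ⟨x, y, z, by linarith⟩)
    have c3 : ∃ i, IsSquare ((3 : ℚ_[2]) * (a i : ℚ_[2])) :=
      no_form h 1 1 5 0 0 0 (by norm_num) (by norm_num) (by norm_num) (fun i hi => by
        obtain ⟨x, y, z, e⟩ := F3 (ha i) hi
        exact ⟨x, y, z, by linarith⟩)
    have c5 : ∃ i, IsSquare ((5 : ℚ_[2]) * (a i : ℚ_[2])) :=
      no_form h 1 2 6 0 0 0 (by norm_num) (by norm_num) (by norm_num) (fun i hi => by
        obtain ⟨x, y, z, e⟩ := F5 (ha i) hi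
        exact ⟨x, y, z, by linarith⟩)
    have c7 : ∃ i, IsSquare ((7 : ℚ_[2]) * (a i : ℚ_[2])) :=
      no_form h 1 1 1 0 0 0 (by norm_num) (by norm_num) (by norm_num) (fun i hi => by
        obtain ⟨x, y, z, e⟩ := F1 (ha i) hi
        exact ⟨x, y, z, by linarith⟩)
    have c10 : ∃ i, IsSquare ((10 : ℚ_[2]) * (a i : ℚ_[2])) :=
      no_form h 1 2 3 0 0 0 (by norm_num) (by norm_num) (by norm_num) (fun i hi => by
        obtain ⟨x, y, z, e⟩ := F4 (ha i) hi
        exact ⟨x, y, z, by linarith⟩)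
    have c14 : ∃ i, IsSquare ((14 : ℚ_[2]) * (a i : ℚ_[2])) :=
      no_form h 1 1 2 0 0 0 (by norm_num) (by norm_num) (by norm_num) (fun i hi => by
        obtain ⟨x, y, z, e⟩ := F2 (ha i) hi
        exact ⟨x, y, z, by linarith⟩)
    intro k
    fin_cases k
    · simpa [cls] using c1
    · simpa [cls] using c2
    · simpa [cls] using c3
    · simpa [cls] using c5
    · simpa [cls] using c7
    · simpa [cls] using c10
    · simpa [cls] using c14
  choose f hf using hcl
  have hinj : Function.Injective f := by
    intro k l hkl
    have h1 := hf k
    rw [hkl] at h1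
    exact Fin.castSucc_injective _ (cls_inj (hne _) h1 (hf l))
  have hsurj : Function.Surjective f := Finite.injective_iff_surjective.1 hinj
  have p2 : ∀ i, ¬ IsSquare ((6 : ℚ_[2]) * (a i : ℚ_[2])) := by
    intro i hi
    obtain ⟨k, rfl⟩ := hsurj i
    have h6 : IsSquare ((cls 7 : ℚ_[2]) * (a (f k) : ℚ_[2])) := by
      have e : cls 7 = 6 := rfl
      rw [e]; exact_mod_cast hi
    have := cls_inj (hne _) (hf k) h6
    have hk := k.isLt
    have := congrArg Fin.val this
    simp at this
    omega
  refine ⟨?_, p2, ?_, ?_, ?_⟩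
  · intro i j hij hsq
    obtain ⟨k, rfl⟩ := hsurj i
    obtain ⟨l, rfl⟩ := hsurj j
    have h1 := hf l
    rw [mul_comm] at h1 hsq
    have h2 := sq_transfer (hne _) hsq h1
    rw [mul_comm] at h2
    have := cls_inj (hne _) (hf k) h2
    exact hij (by rw [Fin.castSucc_injective _ this])
  · obtain ⟨i, hi⟩ : ∃ i, IsSquare ((3 : ℚ_[3]) * (a i : ℚ_[3])) :=
      no_form h 1 1 6 0 0 0 (by norm_num) (by norm_num) (by norm_num) (fun i hi => by
        obtain ⟨x, y, z, e⟩ := F9 (ha i) hi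
        exact ⟨x, y, z, by linarith⟩)
    obtain ⟨j, hj⟩ : ∃ i, IsSquare ((6 : ℚ_[3]) * (a i : ℚ_[3])) :=
      no_form h 1 1 3 0 0 0 (by norm_num) (by norm_num) (by norm_num) (fun i hi => by
        obtain ⟨x, y, z, e⟩ := F8 (ha i) hi
        exact ⟨x, y, z, by linarith⟩)
    exact ⟨i, j, hi, hj⟩
  · obtain ⟨i, hi⟩ : ∃ i, IsSquare ((5 : ℚ_[5]) * (a i : ℚ_[5])) :=
      no_form h 1 2 3 1 0 0 (by norm_num) (by norm_num) (by norm_num) (fun i hi => by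
        obtain ⟨x, y, z, e⟩ := F10 (ha i) hi
        exact ⟨x, y, z, by linarith⟩)
    obtain ⟨j, hj⟩ : ∃ i, IsSquare ((10 : ℚ_[5]) * (a i : ℚ_[5])) :=
      no_form h 1 2 5 0 0 0 (by norm_num) (by norm_num) (by norm_num) (fun i hi => by
        obtain ⟨x, y, z, e⟩ := F11 (ha i) hi
        exact ⟨x, y, z, by linarith⟩)
    exact ⟨i, j, hi, hj⟩
  · refine no_form h 2 2 10 0 0 0 (by norm_num) (by norm_num) (by norm_num) (fun i hi => ?_)
    rw [Nat.not_odd_iff_even] at hi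
    obtain ⟨m, hm⟩ := hi
    have hpos := ha i
    obtain ⟨x, y, z, e⟩ := F3 (n := m) (by omega) (by
      intro hs
      apply p2 i
      have e : (6 : ℚ_[2]) * (a i : ℚ_[2]) = 2 * 2 * (3 * m) := by rw [hm]; push_cast; ring
      rw [e]
      exact IsSquare.mul ⟨2, rfl⟩ hs)
    refine ⟨x, y, z, ?_⟩
    rw [hm]; push_cast
    linarith
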